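/- Let T be a two-branch tree with branches T_1 and T_2 (the two components of T - W(T)). If |W(T)| = 1 and |V(T)| is even, then |V(T_1)| - |V(T_2)| = 1 or |V(T_2)| - |V(T_1)| = 1; in all other cases |V(T_1)| = |V(T_2)|. -/

import Mathlib

open SimpleGraph Finset

open scoped Classical

namespace RadioPaper

variable {V : Type*} [Fintype V] [DecidableEq V]

/-- The diameter of a graph: the maximum distance between two vertices. -/
noncomputable def gdiam (G : SimpleGraph V) : ℕ :=
  Finset.univ.sup fun pr : V × V => G.dist pr.1 pr.2

/-- A radio labelling of `G`: `|f u - f v| ≥ diam G + 1 - d(u,v)` for distinct `u, v`. -/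
def IsRadioLabelling (G : SimpleGraph V) (f : V → ℕ) : Prop :=
  ∀ u v : V, u ≠ v → (gdiam G : ℤ) + 1 - (G.dist u v : ℤ) ≤ |(f u : ℤ) - (f v : ℤ)|

/-- The span of a labelling: the maximum difference between two labels. -/
noncomputable def span (f : V → ℕ) : ℕ :=
  Finset.univ.sup fun pr : V × V => f pr.1 - f pr.2

/-- The radio number of `G`: the minimum span of a radio labelling. -/
noncomputable def radioNumber (G : SimpleGraph V) : ℕ :=
  sInf {s | ∃ f : V → ℕ, IsRadioLabelling G f ∧ span f = s}

/-- The weight of `G` from `v`. -/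
noncomputable def weight (G : SimpleGraph V) (v : V) : ℕ := ∑ u : V, G.dist u v

/-- The set of weight centers: vertices of minimum weight. -/
noncomputable def wcenters (G : SimpleGraph V) : Finset V :=
  Finset.univ.filter fun v => ∀ u : V, weight G v ≤ weight G u

/-- `ε(T) = 2 - |W(T)|`. -/
noncomputable def eps (G : SimpleGraph V) : ℕ := 2 - (wcenters G).card

/-- The level of a vertex: its minimum distance to a weight center. -/
noncomputable def level (G : SimpleGraph V) (u : V) : ℕ :=
  sInf {n | ∃ x ∈ wcenters G, G.dist u x = n}

/-- The total level of `G`. -/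
noncomputable def totalLevel (G : SimpleGraph V) : ℕ := ∑ u : V, level G u

/-- `T` is a two-branch tree: removing the weight centers leaves exactly two components. -/
def TwoBranch (G : SimpleGraph V) : Prop :=
  Nat.card (SimpleGraph.induce {v : V | v ∉ wcenters G} G).ConnectedComponent = 2

/-- The set of remote vertices `S(T)`. -/
noncomputable def remote (G : SimpleGraph V) : Finset V :=
  if (wcenters G).card = 1 then Finset.univ.filter fun u => (gdiam G + 1) / 2 ≤ level G u
  else Finset.univ.filter fun u => gdiam G / 2 ≤ level G u

/-- `ξ(T)`. -/
noncomputable def xi (G : SimpleGraph V) : ℕ :=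
  if (wcenters G).card = 1 then (remote G).card / 2 else (remote G).card - 2

/-- `u` and `v` lie in different branches: the path between them traverses exactly one
weight center. -/
def DiffBranches (G : SimpleGraph V) (u v : V) : Prop :=
  ∀ p : G.Path u v, (p.1.support.filter fun x => decide (x ∈ wcenters G)).length = 1

/-- `u` and `v` lie in opposite branches: the path between them traverses two weight centers. -/
def OppBranches (G : SimpleGraph V) (u v : V) : Prop :=
  ∀ p : G.Path u v, (p.1.support.filter fun x => decide (x ∈ wcenters G)).length = 2

/-- `u` and `v` lie in the same branch of `T - W(T)`. -/
def SameBranch (G : SimpleGraph V) (u v : V) : Prop :=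
  ∃ (hu : u ∉ wcenters G) (hv : v ∉ wcenters G),
    (SimpleGraph.induce {x : V | x ∉ wcenters G} G).Reachable ⟨u, hu⟩ ⟨v, hv⟩

/-- `x` is an ancestor of `v`: `x` lies on the path joining a weight center and `v`. -/
def IsAncestor (G : SimpleGraph V) (x v : V) : Prop :=
  ∃ w ∈ wcenters G, ∀ p : G.Path w v, x ∈ p.1.support

/-- `φ(u,v)`: the maximum level of a common ancestor of `u` and `v`. -/
noncomputable def phi (G : SimpleGraph V) (u v : V) : ℕ :=
  sSup {n | ∃ x : V, IsAncestor G x u ∧ IsAncestor G x v ∧ level G x = n}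

/-- `δ(u,v)`. -/
noncomputable def deltaWC (G : SimpleGraph V) (u v : V) : ℕ :=
  if (wcenters G).card = 2 ∧ ∀ p : G.Path u v, ∀ w ∈ wcenters G, w ∈ p.1.support then 1 else 0

/-- `u` enumerates the vertices of `G` in strictly increasing order of labels under `f`. -/
def IsInducedOrder (G : SimpleGraph V) (f : V → ℕ) (u : ℕ → V) : Prop :=
  (∀ v : V, ∃! i : ℕ, i < Fintype.card V ∧ u i = v) ∧
  ∀ i j : ℕ, i < j → j < Fintype.card V → f (u i) < f (u j)

/-- `J_f(u_t, u_{t+1})`. -/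
noncomputable def Jstep (G : SimpleGraph V) (f : V → ℕ) (u : ℕ → V) (t : ℕ) : ℤ :=
  ((f (u (t+1)) : ℤ) - (f (u t) : ℤ)) + (G.dist (u t) (u (t+1)) : ℤ) - ((gdiam G : ℤ) + 1)

/-- `J_f(u_i, …, u_j)`. -/
noncomputable def Jseg (G : SimpleGraph V) (f : V → ℕ) (u : ℕ → V) (i j : ℕ) : ℤ :=
  ∑ t ∈ Finset.Ico i j, Jstep G f u t

/-- `σ(f)`. -/
noncomputable def sigmaF (G : SimpleGraph V) (f : V → ℕ) (u : ℕ → V) : ℤ :=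
  ∑ t ∈ Finset.range (Fintype.card V - 1),
    (Jstep G f u t + 2 * (phi G (u t) (u (t+1)) : ℤ) - (deltaWC G (u t) (u (t+1)) : ℤ))

/-- Consecutive vertices in the order are in different branches when `|W(T)| = 1`
and in opposite branches when `|W(T)| = 2`. -/
def BranchStep (G : SimpleGraph V) (u v : V) : Prop :=
  ((wcenters G).card = 1 → DiffBranches G u v) ∧
  ((wcenters G).card = 2 → OppBranches G u v)

/-- `f ∈ F`: every pair of consecutive vertices of the induced order is in different
branches when `|W(T)| = 1` and in opposite branches when `|W(T)| = 2`. -/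
def MemF (G : SimpleGraph V) (f : V → ℕ) (u : ℕ → V) : Prop :=
  ∀ i : ℕ, i + 1 < Fintype.card V → BranchStep G (u i) (u (i+1))

/-- `u_i, u_{i+1}` is a bad pair. -/
def BadPair (G : SimpleGraph V) (u : ℕ → V) (i : ℕ) : Prop :=
  i + 1 < Fintype.card V ∧ u i ∉ wcenters G ∧ u (i+1) ∉ wcenters G ∧
    SameBranch G (u i) (u (i+1))

/-- `X_f`: the set of vertices in at least one bad pair. -/
noncomputable def Xf (G : SimpleGraph V) (u : ℕ → V) : Finset V :=
  Finset.univ.filter fun v => ∃ i : ℕ, BadPair G u i ∧ (v = u i ∨ v = u (i+1))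

/-- `[i, j]` is a maximal run of positions (within `[0, p-1]`) satisfying `P`. -/
def IsMaxRun (p : ℕ) (P : ℕ → Prop) (i j : ℕ) : Prop :=
  i ≤ j ∧ j < p ∧ (∀ t, i ≤ t → t ≤ j → P t) ∧ (i = 0 ∨ ¬P (i - 1)) ∧ (j = p - 1 ∨ ¬P (j + 1))

/-- The number of maximal runs of `P` having odd length. -/
noncomputable def oddRunCount (p : ℕ) (P : ℕ → Prop) : ℕ :=
  ((Finset.range p ×ˢ Finset.range p).filter fun ij : ℕ × ℕ =>
    IsMaxRun p P ij.1 ij.2 ∧ Odd (ij.2 - ij.1 + 1)).card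

/-- The linear order `u` is feasible. -/
def Feasible (G : SimpleGraph V) (u : ℕ → V) : Prop :=
  (Even (remote G).card →
    oddRunCount (Fintype.card V) (fun t => u t ∈ remote G) = 0) ∧
  (Odd (remote G).card →
    oddRunCount (Fintype.card V) (fun t => u t ∈ remote G) ≤ 1)

/-- Position `t` is immediately before or after a weight center in the order `u`. -/
def NearWC (G : SimpleGraph V) (u : ℕ → V) (t : ℕ) : Prop :=
  (t + 1 < Fintype.card V ∧ u (t+1) ∈ wcenters G) ∨ (1 ≤ t ∧ u (t-1) ∈ wcenters G)

/-- Position `t` holds a remote vertex not immediately before or after a weight center. -/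
def RemainingRemote (G : SimpleGraph V) (u : ℕ → V) (t : ℕ) : Prop :=
  t < Fintype.card V ∧ u t ∈ remote G ∧ ¬NearWC G u t

/-- The linear order `u` is admissible. -/
def Admissible (G : SimpleGraph V) (u : ℕ → V) : Prop :=
  (∀ t : ℕ, t < Fintype.card V → u t ∈ wcenters G →
    (1 ≤ t → u (t-1) ∈ remote G) ∧ (t + 1 < Fintype.card V → u (t+1) ∈ remote G)) ∧
  (Even ((Finset.range (Fintype.card V)).filter fun t => RemainingRemote G u t).card →
    oddRunCount (Fintype.card V) (RemainingRemote G u) = 0) ∧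
  (Odd ((Finset.range (Fintype.card V)).filter fun t => RemainingRemote G u t).card →
    oddRunCount (Fintype.card V) (RemainingRemote G u) ≤ 1)

/-- Condition (a) of Theorem `thm:lower` on the linear order `u`. -/
def OrderCondA (G : SimpleGraph V) (u : ℕ → V) : Prop :=
  ((wcenters G).card = 1 →
    (Odd (remote G).card →
      level G (u 0) + level G (u (Fintype.card V - 1)) = 1 ∧ Admissible G u) ∧
    (Even (remote G).card →
      (level G (u 0) + level G (u (Fintype.card V - 1)) = 1 ∧
        (Feasible G u ∨ Admissible G u)) ∨
      (level G (u 0) + level G (u (Fintype.card V - 1)) = 2 ∧ Admissible G u))) ∧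
  ((wcenters G).card = 2 →
    Admissible G u ∧
    ((remote G).card = 1 ∨ (remote G).card = 2 →
      level G (u 0) + level G (u (Fintype.card V - 1)) = 0) ∧
    (3 ≤ (remote G).card → Odd (remote G).card →
      level G (u 0) + level G (u (Fintype.card V - 1)) = 1) ∧
    (4 ≤ (remote G).card → Even (remote G).card →
      level G (u 0) + level G (u (Fintype.card V - 1)) = 0 ∨
      level G (u 0) + level G (u (Fintype.card V - 1)) = 2))

/-- Condition (b) of Theorem `thm:lower`: the distance inequality. -/
def OrderCondB (G : SimpleGraph V) (u : ℕ → V) (a : ℕ → ℕ) : Prop :=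
  ∀ i j : ℕ, i < j → j ≤ Fintype.card V - 1 →
    (∑ t ∈ Finset.Ico i j,
      ((level G (u t) : ℤ) + (level G (u (t+1)) : ℤ) - (a t : ℤ)
        - ((gdiam G : ℤ) + (eps G : ℤ))))
      + ((gdiam G : ℤ) + 1) ≤ (G.dist (u i) (u j) : ℤ)

/-- The sequence `a_0, …, a_{p-2}` determined by the order `u` via `(eq:a0)`–`(eq:seq)`. -/
def SeqA (G : SimpleGraph V) (u : ℕ → V) (a : ℕ → ℕ) : Prop :=
  a 0 = 0 ∧
  ∀ t : ℕ, 1 ≤ t → t ≤ Fintype.card V - 2 →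
    a (t-1) + a t =
      if u t ∈ remote G ∧ u (t-1) ∉ wcenters G ∧ u (t+1) ∉ wcenters G
      then (wcenters G).card else 0

/-- The spine index set of the caterpillar `C(n,k)`. -/
def spineSet (n : ℕ) : Finset ℕ :=
  if n % 2 = 1 then {1, (n-1)/2, (n+3)/2, n} else {1, (n-2)/2, (n+4)/2, n}

/-- `G` is (isomorphic to) the caterpillar `C(n,k)`. -/
def IsCaterpillarC (G : SimpleGraph V) (n k : ℕ) : Prop :=
  G.IsTree ∧
  ∃ v : ℕ → V,
    (∀ i j : ℕ, 1 ≤ i → i ≤ n → 1 ≤ j → j ≤ n → v i = v j → i = j) ∧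
    (∀ i : ℕ, 1 ≤ i → i < n → G.Adj (v i) (v (i+1))) ∧
    (∀ x : V, (∃ i : ℕ, 1 ≤ i ∧ i ≤ n ∧ v i = x) ∨ (G.neighborSet x).ncard = 1) ∧
    (∀ i : ℕ, 1 ≤ i → i ≤ n →
      {x ∈ G.neighborSet (v i) | (G.neighborSet x).ncard = 1}.ncard =
        if i ∈ spineSet n then k else 0)

/-- `G` is (isomorphic to) the level-wise regular tree `T^z_{m_0, …, m_{h-1}}`:
a tree with a center `C` of `z` vertices (adjacent when `z = 2`), height `h`,
in which every vertex at distance `i < h` from `C` has degree `m i` and every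
vertex at distance `h` from `C` is a leaf. -/
def IsLevelwiseRegular (G : SimpleGraph V) (z h : ℕ) (m : ℕ → ℕ) : Prop :=
  G.IsTree ∧
  ∃ (C : Finset V) (dC : V → ℕ),
    C.card = z ∧
    (∀ c ∈ C, ∀ c' ∈ C, c ≠ c' → G.Adj c c') ∧
    (∀ x : V, IsLeast {n | ∃ c ∈ C, G.dist x c = n} (dC x)) ∧
    (∀ x : V, dC x ≤ h) ∧
    (∀ x : V, dC x = h → (G.neighborSet x).ncard = 1) ∧
    (∀ x : V, dC x < h → (G.neighborSet x).ncard = m (dC x))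

omit [Fintype V] [DecidableEq V] in
/-- In a tree, a vertex `v` has at most one neighbour closer to `x` than `v`. -/
theorem eq_of_adj_of_dist_lt {G : SimpleGraph V} (hT : G.IsTree) {x v a b : V}
    (ha : G.Adj a v) (hb : G.Adj b v) (hxa : G.dist x a < G.dist x v)
    (hxb : G.dist x b < G.dist x v) : a = b := by
  obtain ⟨p, hp⟩ := hT.connected.exists_walk_length_eq_dist x a
  obtain ⟨q, hq⟩ := hT.connected.exists_walk_length_eq_dist x b
  have hda := hT.dist_eq_dist_add_one_of_adj x ha
  have hdb := hT.dist_eq_dist_add_one_of_adj x hb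
  have hp' : (p.concat ha).IsPath := Walk.isPath_of_length_eq_dist _ (by
    rw [Walk.length_concat]; lia)
  have hq' : (q.concat hb).IsPath := Walk.isPath_of_length_eq_dist _ (by
    rw [Walk.length_concat]; lia)
  have h := (hT.existsUnique_path x v).unique hp' hq'
  simpa using congrArg Walk.penultimate h

omit [Fintype V] [DecidableEq V] in
/-- In a connected graph, every vertex `v ≠ x` has a neighbour closer to `x`. -/
theorem exists_adj_dist_add_one {G : SimpleGraph V} (hG : G.Connected) {x v : V} (hne : v ≠ x) :
    ∃ a, G.Adj a v ∧ G.dist x a + 1 = G.dist x v := by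
  obtain ⟨p, hp⟩ := hG.exists_walk_length_eq_dist v x
  cases p with
  | nil => exact absurd rfl hne
  | cons h q =>
    rename_i a
    refine ⟨a, h.symm, ?_⟩
    have h1 := G.dist_le q
    have h2 := hG.dist_triangle (u := x) (v := a) (w := v)
    rw [Walk.length_cons] at hp
    rw [dist_eq_one_iff_adj.mpr h.symm] at h2
    rw [G.dist_comm (u := v) (v := x)] at hp
    rw [G.dist_comm (u := a) (v := x)] at h1
    lia

omit [Fintype V] [DecidableEq V] in
/-- The only edge leaving the side of `y` of an edge `yw` of a tree is `yw` itself. -/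
theorem eq_of_adj_of_crossing {G : SimpleGraph V} (hT : G.IsTree) {w y a b : V}
    (hwy : G.Adj w y) (hab : G.Adj a b) (ha : G.dist a y < G.dist a w)
    (hb : ¬G.dist b y < G.dist b w) : b = w := by
  have h1 := hT.dist_eq_dist_add_one_of_adj a hwy
  have h2 := hT.dist_eq_dist_add_one_of_adj b hwy
  have h3 := hT.dist_eq_dist_add_one_of_adj w hab
  have h4 := hT.dist_eq_dist_add_one_of_adj y hab
  rw [G.dist_comm (u := w), G.dist_comm (u := w)] at h3
  rw [G.dist_comm (u := y), G.dist_comm (u := y)] at h4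
  by_cases hay : a = y
  · subst hay
    rw [dist_self] at h4
    exact hT.connected.dist_eq_zero_iff.mp (by lia)
  · obtain ⟨c, hc, hd⟩ := exists_adj_dist_add_one hT.connected hay
    have h5 := hT.connected.dist_triangle (u := w) (v := y) (w := c)
    rw [dist_eq_one_iff_adj.mpr hwy] at h5
    have hcb : c = b := eq_of_adj_of_dist_lt hT (x := w) hc hab.symm
      (by rw [G.dist_comm (u := y) (v := a)] at hd; rw [G.dist_comm (u := w) (v := a)]; lia)
      (by rw [G.dist_comm (u := w), G.dist_comm (u := w)]; lia)
    subst hcb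
    rw [G.dist_comm, G.dist_comm (u := y) (v := a)] at hd
    lia

/-- The vertices closer to `u` than to `v`. -/
noncomputable def side (G : SimpleGraph V) (u v : V) : Finset V :=
  Finset.univ.filter fun x => G.dist x u < G.dist x v

omit [DecidableEq V] in
theorem mem_side {G : SimpleGraph V} {u v x : V} :
    x ∈ side G u v ↔ G.dist x u < G.dist x v := by
  simp [side]

omit [DecidableEq V] in
theorem card_side_add_card_side {G : SimpleGraph V} (hT : G.IsTree) {u v : V} (h : G.Adj u v) :
    (side G u v).card + (side G v u).card = Fintype.card V := by
  simp only [side, Finset.card_filter, Fintype.card_eq_sum_ones, ← Finset.sum_add_distrib]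
  refine Finset.sum_congr rfl fun x _ => ?_
  have := hT.dist_eq_dist_add_one_of_adj x h
  split_ifs <;> lia

omit [DecidableEq V] in
theorem weight_add_card_side {G : SimpleGraph V} (hT : G.IsTree) {u v : V} (h : G.Adj u v) :
    weight G u + (side G u v).card = weight G v + (side G v u).card := by
  simp only [side, weight, Finset.card_filter, ← Finset.sum_add_distrib]
  refine Finset.sum_congr rfl fun x _ => ?_
  have := hT.dist_eq_dist_add_one_of_adj x h
  split_ifs <;> lia

omit [DecidableEq V] in
theorem mem_wcenters {G : SimpleGraph V} {v : V} :
    v ∈ wcenters G ↔ ∀ u, weight G v ≤ weight G u := by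
  simp [wcenters]

omit [DecidableEq V] in
theorem wcenters_nonempty [Nonempty V] (G : SimpleGraph V) : (wcenters G).Nonempty := by
  obtain ⟨v, -, hv⟩ := Finset.exists_min_image Finset.univ (weight G) Finset.univ_nonempty
  exact ⟨v, mem_wcenters.mpr fun u => hv u (Finset.mem_univ u)⟩

omit [DecidableEq V] in
/-- Along a path `a, b, c`, the sides of the edges facing `c` strictly shrink. -/
theorem card_side_lt {G : SimpleGraph V} (hT : G.IsTree) {a b c : V} (hab : G.Adj a b)
    (hbc : G.Adj b c) (hac : a ≠ c) : (side G c b).card < (side G b a).card := by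
  refine Finset.card_lt_card (Finset.ssubset_iff_of_subset ?_ |>.mpr ⟨b, ?_, ?_⟩)
  · intro x hx
    rw [mem_side] at hx ⊢
    by_contra h
    have := hT.dist_eq_dist_add_one_of_adj x hab
    exact hac (eq_of_adj_of_dist_lt hT (x := x) hab hbc.symm (by lia) hx)
  · simp [mem_side, dist_eq_one_iff_adj.mpr hab.symm]
  · simp [mem_side]

omit [DecidableEq V] in
theorem two_mul_card_side_le {G : SimpleGraph V} (hT : G.IsTree) {w : V} (hw : w ∈ wcenters G)
    (n : ℕ) {a b : V} (hab : G.Adj a b) (ha : G.dist w a = n) (hb : G.dist w b = n + 1) :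
    2 * (side G b a).card + n ≤ Fintype.card V := by
  induction n generalizing a b with
  | zero =>
    obtain rfl := hT.connected.dist_eq_zero_iff.mp ha
    have h1 := mem_wcenters.mp hw b
    have h2 := weight_add_card_side hT hab
    have h3 := card_side_add_card_side hT hab
    lia
  | succ n ih =>
    have hne : a ≠ w := by
      rintro rfl
      simp at ha
    obtain ⟨c, hc, hd⟩ := exists_adj_dist_add_one hT.connected hne
    have hcb : c ≠ b := by
      rintro rfl
      lia
    have h1 := card_side_lt hT hc hab hcb
    have h2 := ih hc (by lia) ha
    lia

omit [DecidableEq V] in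
theorem adj_of_mem_wcenters {G : SimpleGraph V} (hT : G.IsTree) {w z : V} (hw : w ∈ wcenters G)
    (hz : z ∈ wcenters G) (hne : z ≠ w) : G.Adj w z := by
  obtain ⟨a, ha, hd⟩ := exists_adj_dist_add_one hT.connected hne
  have h1 := two_mul_card_side_le hT hw _ ha rfl hd.symm
  have h2 := mem_wcenters.mp hz a
  have h3 := weight_add_card_side hT ha
  have h4 := card_side_add_card_side hT ha
  obtain rfl := hT.connected.dist_eq_zero_iff.mp (show G.dist w a = 0 by lia)
  exact ha

omit [DecidableEq V] in
theorem card_wcenters_le_two {G : SimpleGraph V} (hT : G.IsTree) : (wcenters G).card ≤ 2 := by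
  by_contra! h
  obtain ⟨a, ha, b, hb, c, hc, hab, hac, hbc⟩ := Finset.two_lt_card.mp h
  apply hT.dist_ne_of_adj a (adj_of_mem_wcenters hT hb hc hbc.symm)
  rw [dist_eq_one_iff_adj.mpr (adj_of_mem_wcenters hT ha hb hab.symm),
    dist_eq_one_iff_adj.mpr (adj_of_mem_wcenters hT ha hc hac.symm)]

omit [DecidableEq V] in
/-- A branch hanging off a weight center `w` lies on the far side of an edge at `w`. -/
theorem exists_adj_branch_subset_side {G : SimpleGraph V} (hT : G.IsTree) {w : V}
    (hw : w ∈ wcenters G)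
    (c : (SimpleGraph.induce {v : V | v ∉ wcenters G} G).ConnectedComponent) :
    ∃ y, G.Adj w y ∧ ∀ v ∈ c.supp, (v : V) ∈ side G y w := by
  obtain ⟨v, hv⟩ := c.nonempty_supp
  have hvw : w ≠ v := fun h => v.2 (h ▸ hw)
  obtain ⟨y, hy, hd⟩ := exists_adj_dist_add_one hT.connected hvw
  refine ⟨y, hy.symm, fun u hu => ?_⟩
  have hr : (SimpleGraph.induce {v : V | v ∉ wcenters G} G).Reachable v u :=
    ConnectedComponent.exact (hv.trans hu.symm)
  rw [reachable_iff_reflTransGen] at hr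
  induction hr with
  | refl => exact mem_side.mpr (by lia)
  | @tail a b hva hab ih =>
    have ha : (a : V) ∈ side G y w := ih (by
      rw [ConnectedComponent.mem_supp_iff, ← hv]
      exact (ConnectedComponent.sound ((reachable_iff_reflTransGen _ _).mpr hva)).symm)
    by_contra hb
    rw [mem_side] at ha hb
    have hbw := eq_of_adj_of_crossing hT hy.symm (a := a) (b := b) hab ha hb
    exact b.2 (hbw ▸ hw)

omit [DecidableEq V] in
theorem two_mul_ncard_branch_le {G : SimpleGraph V} (hT : G.IsTree)
    (c : (SimpleGraph.induce {v : V | v ∉ wcenters G} G).ConnectedComponent) :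
    2 * c.supp.ncard + (wcenters G).card ≤ Fintype.card V := by
  have := hT.connected.nonempty
  obtain ⟨w, hw⟩ := wcenters_nonempty G
  obtain ⟨y, hwy, hc⟩ := exists_adj_branch_subset_side hT hw c
  have hsub : Set.image Subtype.val c.supp ⊆ (↑(side G y w \ wcenters G) : Set V) := by
    rintro _ ⟨v, hv, rfl⟩
    simpa using ⟨hc v hv, v.2⟩
  have hle : c.supp.ncard ≤ (side G y w \ wcenters G).card := by
    rw [← Set.ncard_image_of_injective _ Subtype.val_injective, ← Set.ncard_coe_finset]
    exact Set.ncard_le_ncard hsub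
  have h2 := card_wcenters_le_two hT
  have hweight := weight_add_card_side hT hwy
  have hsum := card_side_add_card_side hT hwy
  have hmin := mem_wcenters.mp hw
  by_cases hy : y ∈ wcenters G
  · have hlt : (side G y w \ wcenters G).card < (side G y w).card := by
      refine Finset.card_lt_card (Finset.ssubset_iff_of_subset Finset.sdiff_subset |>.mpr
        ⟨y, ?_, by simp [hy]⟩)
      simp [mem_side, dist_eq_one_iff_adj.mpr hwy.symm]
    have := hmin y
    lia
  · have hlt : weight G w < weight G y := by
      by_contra! h
      exact hy (mem_wcenters.mpr fun u => h.trans (hmin u))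
    have hle' := Finset.card_le_card (Finset.sdiff_subset (s := side G y w) (t := wcenters G))
    rcases Nat.lt_or_ge (wcenters G).card 2 with h1 | h1
    · lia
    · obtain ⟨z, hz, hzw⟩ := Finset.exists_mem_ne (by lia : 1 < (wcenters G).card) w
      have hadj := adj_of_mem_wcenters hT hw hz hzw
      have h3 := weight_add_card_side hT hadj
      have h4 := card_side_add_card_side hT hadj
      have h5 := hmin z
      have h6 := mem_wcenters.mp hz w
      lia

omit [DecidableEq V] in
theorem ncard_branch_add_ncard_branch {G : SimpleGraph V} (h2 : TwoBranch G)
    {c1 c2 : (SimpleGraph.induce {v : V | v ∉ wcenters G} G).ConnectedComponent}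
    (hne : c1 ≠ c2) :
    c1.supp.ncard + c2.supp.ncard + (wcenters G).card = Fintype.card V := by
  obtain ⟨x, y, -, hxy⟩ := Nat.card_eq_two_iff.mp h2
  have hcover (c) : c = c1 ∨ c = c2 := by
    have h (d) : d = x ∨ d = y := by
      have : d ∈ ({x, y} : Set _) := hxy ▸ Set.mem_univ d
      simpa using this
    have h0 := h c
    have h1 := h c1
    have h2 := h c2
    grind
  have hdisj : Disjoint c1.supp c2.supp :=
    SimpleGraph.pairwise_disjoint_supp_connectedComponent _ hne
  have huniv : c1.supp ∪ c2.supp = Set.univ := by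
    refine Set.eq_univ_of_forall fun v => ?_
    exact hcover ((SimpleGraph.induce {v : V | v ∉ wcenters G} G).connectedComponentMk v)
  rw [← Set.ncard_union_eq hdisj, huniv, Set.ncard_univ, ← Nat.card_eq_fintype_card]
  have := Set.ncard_compl_add_ncard (↑(wcenters G) : Set V)
  rwa [Set.ncard_coe_finset] at this

/-- **Lemma (branch sizes).** Let `T` be a two-branch tree with branches `T_1`, `T_2`.
If `|W(T)| = 1` and `|V(T)|` is even, then `|V(T_1)|` and `|V(T_2)|` differ by one;
otherwise `|V(T_1)| = |V(T_2)|`. -/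
theorem stmt10 {V : Type*} [Fintype V] [DecidableEq V] (G : SimpleGraph V)
    (hT : G.IsTree) (h2 : TwoBranch G)
    (c1 c2 : (SimpleGraph.induce {v : V | v ∉ wcenters G} G).ConnectedComponent)
    (hne : c1 ≠ c2) :
    ((wcenters G).card = 1 ∧ Even (Fintype.card V) →
      c1.supp.ncard = c2.supp.ncard + 1 ∨ c2.supp.ncard = c1.supp.ncard + 1) ∧
    (¬((wcenters G).card = 1 ∧ Even (Fintype.card V)) →
      c1.supp.ncard = c2.supp.ncard) := by
  have h1 := two_mul_ncard_branch_le hT c1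
  have h3 := two_mul_ncard_branch_le hT c2
  have h4 := ncard_branch_add_ncard_branch h2 hne
  refine ⟨fun ⟨hw, k, hk⟩ => ?_, fun _ => ?_⟩ <;> lia

end RadioPaper
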